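/- Let χ be the unique primitive quadratic Dirichlet character modulo 15 (it is odd, with χ(1) = χ(2) = χ(4) = χ(8) = 1 and χ(7) = χ(11) = χ(13) = χ(14) = −1). Its analytically continued Dirichlet L-function satisfies L(χ,−2) = −16, L(χ,−4) = 992, and L(χ,−6) = −165616. -/

import Mathlib

open DirichletCharacter

/-- Values at negative integers of the `L`-function of a function on `ZMod N`, in terms of
Bernoulli polynomials. -/
theorem ZMod.LFunction_neg_nat {N : ℕ} [NeZero N] (Φ : ZMod N → ℂ) {k : ℕ} (hk : k ≠ 0) :
    ZMod.LFunction Φ (-k) = -(N : ℂ) ^ k / (k + 1) *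
      ∑ j : ZMod N, Φ j * ((Polynomial.bernoulli (k + 1)).eval (j.val / N : ℚ) : ℚ) := by
  have hζ (j : ZMod N) : HurwitzZeta.hurwitzZeta (ZMod.toAddCircle j) (-k) =
      -1 / (k + 1) * ((Polynomial.bernoulli (k + 1)).eval (j.val / N : ℚ) : ℚ) := by
    have hj : (j.val / N : ℝ) ∈ Set.Icc 0 1 :=
      ⟨by positivity, div_le_one_of_le₀ (by exact_mod_cast j.val_lt.le) (by positivity)⟩
    rw [ZMod.toAddCircle_apply, HurwitzZeta.hurwitzZeta_neg_nat hk hj]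
    have hcast : (((j.val / N : ℝ) : ℝ) : ℂ) = algebraMap ℚ ℂ (j.val / N : ℚ) := by
      simp [-ZMod.natCast_val]
    rw [hcast, Polynomial.eval_map_algebraMap, Polynomial.aeval_algebraMap_apply,
      Polynomial.coe_aeval_eq_eval, eq_ratCast]
  rw [ZMod.LFunction, neg_neg, Complex.cpow_natCast, Finset.mul_sum, Finset.mul_sum]
  refine Finset.sum_congr rfl fun j _ => ?_
  rw [hζ]
  ring

theorem bernoulli_three : bernoulli 3 = 0 :=
  bernoulli_eq_zero_of_odd (by decide) (by norm_num)

theorem bernoulli_four : bernoulli 4 = -1 / 30 := by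
  rw [bernoulli_eq_bernoulli'_of_ne_one (by norm_num), bernoulli'_four]

theorem bernoulli_five : bernoulli 5 = 0 :=
  bernoulli_eq_zero_of_odd (by decide) (by norm_num)

theorem bernoulli_six : bernoulli 6 = 1 / 42 := by
  have h := sum_bernoulli 7
  simp [Finset.sum_range_succ, bernoulli_two, bernoulli_three, bernoulli_four, bernoulli_five,
    Nat.choose] at h
  linarith

theorem Polynomial.bernoulli_three_eval (x : ℚ) :
    (Polynomial.bernoulli 3).eval x = x ^ 3 - 3 / 2 * x ^ 2 + 1 / 2 * x := by
  simp [Polynomial.bernoulli, Finset.sum_range_succ, bernoulli_two, bernoulli_three,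
    Nat.choose]
  ring

theorem Polynomial.bernoulli_five_eval (x : ℚ) :
    (Polynomial.bernoulli 5).eval x = x ^ 5 - 5 / 2 * x ^ 4 + 5 / 3 * x ^ 3 - 1 / 6 * x := by
  simp [Polynomial.bernoulli, Finset.sum_range_succ, bernoulli_two, bernoulli_three,
    bernoulli_four, bernoulli_five, Nat.choose]
  ring

theorem Polynomial.bernoulli_seven_eval (x : ℚ) :
    (Polynomial.bernoulli 7).eval x =
      x ^ 7 - 7 / 2 * x ^ 6 + 7 / 2 * x ^ 5 - 7 / 6 * x ^ 3 + 1 / 6 * x := by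
  have h7 : _root_.bernoulli 7 = 0 := bernoulli_eq_zero_of_odd (by decide) (by norm_num)
  simp [Polynomial.bernoulli, Finset.sum_range_succ, bernoulli_two, bernoulli_three,
    bernoulli_four, bernoulli_five, bernoulli_six, h7, Nat.choose]
  ring

/-- **§9.4 of the paper, row `a = 15`.** Values of the Dirichlet `L`-function of the primitive
quadratic Dirichlet character modulo `15` (with `χ(1) = χ(2) = χ(4) = χ(8) = 1` and
`χ(7) = χ(11) = χ(13) = χ(14) = −1`) at negative even integers. -/
theorem LFunction_mod_fifteen_values (χ : DirichletCharacter ℂ 15)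
    (h1 : χ (1 : ZMod 15) = 1) (h2 : χ (2 : ZMod 15) = 1)
    (h4 : χ (4 : ZMod 15) = 1) (h8 : χ (8 : ZMod 15) = 1)
    (h7 : χ (7 : ZMod 15) = -1) (h11 : χ (11 : ZMod 15) = -1)
    (h13 : χ (13 : ZMod 15) = -1) (h14 : χ (14 : ZMod 15) = -1) :
    LFunction χ (-2) = -16 ∧
    LFunction χ (-4) = 992 ∧
    LFunction χ (-6) = -165616 := by
  have hsum (f : ℕ → ℂ) : ∑ j : ZMod 15, χ j * f j.val =
      f 1 + f 2 + f 4 + f 8 - f 7 - f 11 - f 13 - f 14 := by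
    have hzero (a : ZMod 15) (ha : ¬ IsUnit a) : χ a = 0 := χ.map_nonunit ha
    have h0 := hzero 0 (by decide)
    have h3 := hzero 3 (by decide)
    have h5 := hzero 5 (by decide)
    have h6 := hzero 6 (by decide)
    have h9 := hzero 9 (by decide)
    have h10 := hzero 10 (by decide)
    have h12 := hzero 12 (by decide)
    have huniv : (Finset.univ : Finset (ZMod 15)) =
        {0, 1, 2, 3, 4, 5, 6, 7, 8, 9, 10, 11, 12, 13, 14} := by decide
    have hv : (1 : ZMod 15).val = 1 ∧ (2 : ZMod 15).val = 2 ∧ (4 : ZMod 15).val = 4 ∧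
        (8 : ZMod 15).val = 8 ∧ (7 : ZMod 15).val = 7 ∧ (11 : ZMod 15).val = 11 ∧
        (13 : ZMod 15).val = 13 ∧ (14 : ZMod 15).val = 14 := by decide
    obtain ⟨v1, v2, v4, v8, v7, v11, v13, v14⟩ := hv
    rw [huniv]
    repeat rw [Finset.sum_insert (by decide)]
    rw [Finset.sum_singleton, h0, h1, h2, h3, h4, h5, h6, h7, h8, h9, h10, h11, h12, h13, h14,
      v1, v2, v4, v7, v8, v11, v13, v14]
    ring
  have hL (k : ℕ) (hk : k ≠ 0) := (ZMod.LFunction_neg_nat χ hk).trans <|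
    congrArg (-((15 : ℕ) : ℂ) ^ k / (k + 1) * ·) <|
      hsum fun n => ((Polynomial.bernoulli (k + 1)).eval (n / (15 : ℕ) : ℚ) : ℚ)
  refine ⟨?_, ?_, ?_⟩
  · have h := hL 2 (by norm_num)
    simp only [Nat.reduceAdd, Polynomial.bernoulli_three_eval] at h
    rw [LFunction]
    push_cast at h
    rw [h]
    norm_num
  · have h := hL 4 (by norm_num)
    simp only [Nat.reduceAdd, Polynomial.bernoulli_five_eval] at h
    rw [LFunction]
    push_cast at h
    rw [h]
    norm_num
  · have h := hL 6 (by norm_num)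
    simp only [Nat.reduceAdd, Polynomial.bernoulli_seven_eval] at h
    rw [LFunction]
    push_cast at h
    rw [h]
    norm_num
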